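/- For every C ≥ 1 and every Δ ∈ ℕ there exists a constant A < ∞ such that the following holds: for every finite connected graph G = (V, E) with n ≥ 3 vertices and maximum degree at most Δ, and every conductance function c : E → [1, C], the lazy random walks satisfy t_mix(G, c) ≤ A · (1 + t_mix(G, 1)) · log n and t_mix(G, 1) ≤ A · (1 + t_mix(G, c)) · log n, where t_mix(G, 1) is the mixing time with unit conductances. In other words, perturbing unit conductances by factors of at most C can change the mixing time of a bounded-degree graph by at most a factor of order log n. -/

import Mathlib

open Finset
open scoped Classical

variable {V : Type*} [Fintype V]

/-- Transition matrix of the lazy random walk on the network `(G, c)`: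
stay put with probability `1/2`, otherwise move to a neighbour `u` with
probability proportional to the conductance `c v u`. -/
noncomputable def lazyKernel (G : SimpleGraph V) (c : V → V → ℝ) : Matrix V V ℝ :=
  fun v u =>
    (if v = u then (1 : ℝ) / 2 else 0) +
    (if G.Adj v u then c v u / (2 * ∑ w ∈ Finset.univ.filter (G.Adj v ·), c v w) else 0)

/-- Stationary distribution of the lazy random walk on the network `(G, c)`:
`π(v)` is proportional to the total conductance at `v`. -/
noncomputable def statDist (G : SimpleGraph V) (c : V → V → ℝ) (v : V) : ℝ :=
  (∑ w ∈ Finset.univ.filter (G.Adj v ·), c v w) /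
    (∑ u, ∑ w ∈ Finset.univ.filter (G.Adj u ·), c u w)

/-- Total variation distance between two (signed) measures on a finite set. -/
noncomputable def tvDist (μ ν : V → ℝ) : ℝ := (1 / 2) * ∑ x, |μ x - ν x|

/-- Mixing time of the lazy random walk on `(G, c)` started at `v`. -/
noncomputable def mixingTimeFrom [DecidableEq V] (G : SimpleGraph V) (c : V → V → ℝ)
    (v : V) : ℕ :=
  sInf {t : ℕ | tvDist ((lazyKernel G c ^ t) v) (statDist G c) ≤ 1 / 4}

/-- Mixing time of the lazy random walk on the network `(G, c)`. -/
noncomputable def mixingTime [DecidableEq V] (G : SimpleGraph V) (c : V → V → ℝ) : ℕ :=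
  Finset.univ.sup fun v => mixingTimeFrom G c v


namespace MixRobust

/-- weighted degree -/
noncomputable def dg (a : V → V → ℝ) (v : V) : ℝ := ∑ w, a v w

/-- non-lazy averaging operator -/
noncomputable def Q (a : V → V → ℝ) (f : V → ℝ) (v : V) : ℝ := (∑ w, a v w * f w) / dg a v

/-- lazy averaging operator -/
noncomputable def T (a : V → V → ℝ) (f : V → ℝ) (v : V) : ℝ := (f v + Q a f v) / 2

/-- squared weighted norm -/
noncomputable def N (a : V → V → ℝ) (f : V → ℝ) : ℝ := ∑ v, dg a v * f v ^ 2

/-- Dirichlet energy -/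
noncomputable def En (a : V → V → ℝ) (f : V → ℝ) : ℝ :=
  (1 / 4) * ∑ v, ∑ w, a v w * (f v - f w) ^ 2

/-- good weights -/
structure Good (a : V → V → ℝ) : Prop where
  symm : ∀ u v, a u v = a v u
  nonneg : ∀ u v, 0 ≤ a u v
  pos : ∀ v, 0 < dg a v

variable {a : V → V → ℝ}

lemma dg_mul_Q (h : Good a) (f : V → ℝ) (v : V) : dg a v * Q a f v = ∑ w, a v w * f w := by
  unfold Q
  rw [mul_div_cancel₀ _ (h.pos v).ne']

lemma dg_mul_T (h : Good a) (f : V → ℝ) (v : V) :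
    dg a v * T a f v = (dg a v * f v + ∑ w, a v w * f w) / 2 := by
  rw [← dg_mul_Q h]; unfold T; ring

lemma N_nonneg (h : Good a) (f : V → ℝ) : 0 ≤ N a f :=
  Finset.sum_nonneg fun v _ => mul_nonneg (h.pos v).le (sq_nonneg _)

lemma En_nonneg (h : Good a) (f : V → ℝ) : 0 ≤ En a f :=
  mul_nonneg (by norm_num) (Finset.sum_nonneg fun v _ => Finset.sum_nonneg fun w _ =>
    mul_nonneg (h.nonneg _ _) (sq_nonneg _))

lemma sum_swap (h : Good a) (f : V → ℝ) : ∑ v, ∑ w, a v w * f w = ∑ v, dg a v * f v := by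
  rw [Finset.sum_comm]
  refine Finset.sum_congr rfl fun w _ => ?_
  rw [dg, Finset.sum_mul]
  exact Finset.sum_congr rfl fun v _ => by rw [h.symm]

lemma mean_T (h : Good a) (f : V → ℝ) : ∑ v, dg a v * T a f v = ∑ v, dg a v * f v := by
  simp_rw [dg_mul_T h]
  rw [← Finset.sum_div, Finset.sum_add_distrib, sum_swap h]
  ring

lemma sup_T (h : Good a) (f : V → ℝ) (M : ℝ) (hM : ∀ v, |f v| ≤ M) (v : V) : |T a f v| ≤ M := by
  have h1 : |Q a f v| ≤ M := by
    unfold Q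
    rw [abs_div, abs_of_pos (h.pos v), div_le_iff₀ (h.pos v)]
    calc |∑ w, a v w * f w| ≤ ∑ w, |a v w * f w| := Finset.abs_sum_le_sum_abs _ _
      _ ≤ ∑ w, M * a v w := by
          refine Finset.sum_le_sum fun w _ => ?_
          rw [abs_mul, abs_of_nonneg (h.nonneg v w), mul_comm]
          exact mul_le_mul_of_nonneg_right (hM w) (h.nonneg v w)
      _ = M * dg a v := by rw [dg, Finset.mul_sum]
  have h2 := hM v
  rw [abs_le] at *
  unfold T
  constructor <;> linarith [h1.1, h1.2, h2.1, h2.2]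

lemma selfadj (h : Good a) (f g : V → ℝ) :
    ∑ v, dg a v * (T a f v * g v) = ∑ v, dg a v * (f v * T a g v) := by
  have e1 : ∀ v, dg a v * (T a f v * g v) =
      (dg a v * f v * g v + ∑ w, a v w * f w * g v) / 2 := fun v => by
    rw [← mul_assoc, dg_mul_T h, ← Finset.sum_mul]; ring
  have e2 : ∀ v, dg a v * (f v * T a g v) =
      (dg a v * f v * g v + ∑ w, a v w * f v * g w) / 2 := fun v => by
    have : dg a v * (f v * T a g v) = f v * (dg a v * T a g v) := by ring
    rw [this, dg_mul_T h]
    have : ∑ w, a v w * f v * g w = f v * ∑ w, a v w * g w := by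
      rw [Finset.mul_sum]; exact Finset.sum_congr rfl fun w _ => by ring
    rw [this]; ring
  simp_rw [e1, e2]
  rw [← Finset.sum_div, ← Finset.sum_div, Finset.sum_add_distrib, Finset.sum_add_distrib]
  congr 2
  rw [Finset.sum_comm]
  exact Finset.sum_congr rfl fun v _ => Finset.sum_congr rfl fun w _ => by rw [h.symm]

lemma energy (h : Good a) (f : V → ℝ) :
    N a f - ∑ v, dg a v * (f v * T a f v) = En a f := by
  have e2 : ∀ v, dg a v * (f v * T a f v) =
      (dg a v * f v ^ 2 + ∑ w, a v w * f v * f w) / 2 := fun v => by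
    have : dg a v * (f v * T a f v) = f v * (dg a v * T a f v) := by ring
    rw [this, dg_mul_T h]
    have : ∑ w, a v w * f v * f w = f v * ∑ w, a v w * f w := by
      rw [Finset.mul_sum]; exact Finset.sum_congr rfl fun w _ => by ring
    rw [this]; ring
  simp_rw [e2]
  rw [← Finset.sum_div, Finset.sum_add_distrib]
  have e3 : ∑ v, ∑ w, a v w * (f v - f w) ^ 2 =
      ∑ v, ∑ w, a v w * f v ^ 2 + ∑ v, ∑ w, a v w * f w ^ 2
        - 2 * ∑ v, ∑ w, a v w * f v * f w := by
    simp_rw [Finset.mul_sum, ← Finset.sum_add_distrib, ← Finset.sum_sub_distrib]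
    exact Finset.sum_congr rfl fun v _ => Finset.sum_congr rfl fun w _ => by ring
  have e4 : ∑ v, ∑ w, a v w * f w ^ 2 = N a f := sum_swap h fun w => f w ^ 2
  have e5 : ∑ v, ∑ w, a v w * f v ^ 2 = N a f := by
    unfold N dg; simp_rw [Finset.sum_mul]
  have e6 : ∑ v, dg a v * f v ^ 2 = N a f := rfl
  unfold En
  rw [e3, e4, e5, e6]; ring

lemma N_Q_le (h : Good a) (f : V → ℝ) : N a (Q a f) ≤ N a f := by
  have e4 : ∑ v, ∑ w, a v w * f w ^ 2 = N a f := sum_swap h fun w => f w ^ 2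
  rw [← e4]
  refine Finset.sum_le_sum fun v _ => ?_
  have hcs : (∑ w, a v w * f w) ^ 2 ≤ (∑ w, a v w) * ∑ w, a v w * f w ^ 2 := by
    refine Finset.sum_sq_le_sum_mul_sum_of_sq_eq_mul _ (fun w _ => h.nonneg v w)
      (fun w _ => mul_nonneg (h.nonneg v w) (sq_nonneg _)) fun w _ => by ring
  have hp := h.pos v
  have : dg a v * Q a f v ^ 2 = (∑ w, a v w * f w) ^ 2 / dg a v := by
    unfold Q; field_simp
  rw [this, div_le_iff₀ hp, mul_comm]
  exact hcs

lemma N_T_le (h : Good a) (f : V → ℝ) : N a (T a f) ≤ N a f - En a f := by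
  have h1 : ∑ v, dg a v * (f v * T a f v) - N a (T a f) = (N a f - N a (Q a f)) / 4 := by
    unfold N
    rw [← Finset.sum_sub_distrib, ← Finset.sum_sub_distrib, Finset.sum_div]
    refine Finset.sum_congr rfl fun v _ => ?_
    unfold T; ring
  have := energy h f
  have := N_Q_le h f
  linarith

lemma En_lower (h : Good a) (f : V → ℝ) : (N a f - N a (T a f)) / 2 ≤ En a f := by
  rw [← energy h f]
  have : 0 ≤ ∑ v, dg a v * (f v - T a f v) ^ 2 :=
    Finset.sum_nonneg fun v _ => mul_nonneg (h.pos v).le (sq_nonneg _)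
  have e : ∑ v, dg a v * (f v - T a f v) ^ 2 =
      N a f + N a (T a f) - 2 * ∑ v, dg a v * (f v * T a f v) := by
    unfold N
    rw [Finset.mul_sum, ← Finset.sum_add_distrib, ← Finset.sum_sub_distrib]
    exact Finset.sum_congr rfl fun v _ => by ring
  linarith

lemma mean_iter (h : Good a) (k : ℕ) (f : V → ℝ) :
    ∑ v, dg a v * ((T a)^[k] f) v = ∑ v, dg a v * f v := by
  induction k with
  | zero => rfl
  | succ k ih => rw [Function.iterate_succ_apply', mean_T h, ih]

lemma sup_iter (h : Good a) (k : ℕ) (f : V → ℝ) (M : ℝ) (hM : ∀ v, |f v| ≤ M) :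
    ∀ v, |((T a)^[k] f) v| ≤ M := by
  induction k with
  | zero => exact hM
  | succ k ih => rw [Function.iterate_succ_apply']; exact sup_T h _ _ ih

lemma T_sub_const (h : Good a) (f : V → ℝ) (μ : ℝ) :
    T a (fun v => f v - μ) = fun v => T a f v - μ := by
  funext v
  have hp := (h.pos v).ne'
  have : Q a (fun v => f v - μ) v = Q a f v - μ := by
    unfold Q
    simp_rw [mul_sub]
    rw [Finset.sum_sub_distrib, ← Finset.sum_mul, sub_div]
    congr 1
    change dg a v * μ / dg a v = μ
    field_simp
  unfold T
  rw [this]; ring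

lemma iter_sub_const (h : Good a) (k : ℕ) (f : V → ℝ) (μ : ℝ) :
    (T a)^[k] (fun v => f v - μ) = fun v => ((T a)^[k] f) v - μ := by
  induction k with
  | zero => rfl
  | succ k ih => rw [Function.iterate_succ_apply', ih, T_sub_const h, Function.iterate_succ_apply']

/-- log-convexity of the norms along the iteration -/
lemma logconv (h : Good a) (f : V → ℝ) : N a (T a f) ^ 2 ≤ N a f * N a (T a (T a f)) := by
  have e : N a (T a f) = ∑ v, dg a v * (f v * T a (T a f) v) := by
    rw [← selfadj h]
    exact Finset.sum_congr rfl fun v _ => by ring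
  rw [e]
  refine Finset.sum_sq_le_sum_mul_sum_of_sq_eq_mul _
    (fun w _ => mul_nonneg (h.pos w).le (sq_nonneg _))
    (fun w _ => mul_nonneg (h.pos w).le (sq_nonneg _)) fun w _ => by ring

lemma seq_lower (b : ℕ → ℝ) (hb : ∀ j, 0 ≤ b j) (h0 : 0 < b 0)
    (hl : ∀ j, b (j + 1) ^ 2 ≤ b j * b (j + 2)) (j : ℕ) : (b 1 / b 0) ^ j * b 0 ≤ b j := by
  have key : ∀ j, b 1 * b j ≤ b 0 * b (j + 1) := by
    intro j
    induction j with
    | zero => rw [mul_comm]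
    | succ j ih =>
      rcases (hb j).eq_or_lt with hz | hz
      · have h1 := hl j
        rw [← hz, zero_mul] at h1
        have : b (j + 1) = 0 := by
          have := sq_nonneg (b (j + 1))
          exact pow_eq_zero_iff (two_ne_zero) |>.1 (le_antisymm h1 this)
        rw [this, mul_zero]
        exact mul_nonneg (hb _) (hb _)
      · have h1 := hl j
        have h2 := mul_le_mul_of_nonneg_right ih (hb (j + 1))
        have h3 := mul_le_mul_of_nonneg_left h1 h0.le
        have : b j * (b 1 * b (j + 1)) ≤ b j * (b 0 * b (j + 1 + 1)) := by
          have e : b (j + 1 + 1) = b (j + 2) := rfl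
          rw [e]; nlinarith
        exact le_of_mul_le_mul_left this hz
  induction j with
  | zero => simp
  | succ j ih =>
    have h1 := key j
    rw [pow_succ]
    have h2 : (b 1 / b 0) * ((b 1 / b 0) ^ j * b 0) ≤ (b 1 / b 0) * b j :=
      mul_le_mul_of_nonneg_left ih (div_nonneg (hb _) (hb _))
    have h3 : (b 1 / b 0) * b j ≤ b (j + 1) := by
      rw [div_mul_eq_mul_div, div_le_iff₀ h0]; linarith
    linarith

/-- Sup-norm contraction after `t` steps gives a Poincare inequality. -/
lemma gap_of_contract (h : Good a) (t : ℕ)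
    (hc : ∀ (f : V → ℝ) (M : ℝ), ∑ v, dg a v * f v = 0 → (∀ v, |f v| ≤ M) →
      ∀ v, |((T a)^[t] f) v| ≤ M / 2)
    (f : V → ℝ) (hf : ∑ v, dg a v * f v = 0) : N a f ≤ 4 * t * En a f := by
  rcases (N_nonneg h f).eq_or_lt with hz | hpos
  · rw [← hz]; exact mul_nonneg (by positivity) (En_nonneg h f)
  set b : ℕ → ℝ := fun j => N a ((T a)^[j] f) with hbdef
  have hb : ∀ j, 0 ≤ b j := fun j => N_nonneg h _
  have hl : ∀ j, b (j + 1) ^ 2 ≤ b j * b (j + 2) := by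
    intro j
    simp only [hbdef, Function.iterate_succ_apply']
    exact logconv h _
  have hpos' : 0 < b 0 := hpos
  have hlow := seq_lower b hb hpos' hl
  set M : ℝ := ∑ v, |f v| with hM
  have hfM : ∀ v, |f v| ≤ M := fun v =>
    Finset.single_le_sum (f := fun v => |f v|) (fun i _ => abs_nonneg _) (Finset.mem_univ v)
  have hsup : ∀ m : ℕ, ∀ v, |((T a)^[t * m] f) v| ≤ M / 2 ^ m := by
    intro m
    induction m with
    | zero => simpa using hfM
    | succ m ih =>
      intro v
      have := hc ((T a)^[t * m] f) (M / 2 ^ m) (by rw [mean_iter h, hf]) ih v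
      rw [← Function.iterate_add_apply] at this
      rw [show t * (m + 1) = t + t * m by ring, pow_succ, ← div_div]
      exact this
  set μ := b 1 / b 0 with hμ
  have hμ0 : 0 ≤ μ := div_nonneg (hb _) (hb _)
  set Z := ∑ v, dg a v with hZ
  have hbound : ∀ m : ℕ, (4 * μ ^ t) ^ m ≤ Z * M ^ 2 / b 0 := by
    intro m
    rw [le_div_iff₀ hpos']
    have h1 : b (t * m) ≤ Z * (M / 2 ^ m) ^ 2 := by
      rw [hZ, Finset.sum_mul]
      refine Finset.sum_le_sum fun v _ => mul_le_mul_of_nonneg_left ?_ (h.pos v).le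
      rw [← sq_abs]
      exact pow_le_pow_left₀ (abs_nonneg _) (hsup m v) 2
    have h2 := (hlow (t * m)).trans h1
    rw [mul_pow, ← pow_mul]
    have h4 : (4 : ℝ) ^ m = (2 ^ m) ^ 2 := by rw [← pow_mul, mul_comm, pow_mul]; norm_num
    have h5 : Z * (M / 2 ^ m) ^ 2 * 4 ^ m = Z * M ^ 2 := by
      rw [h4]; field_simp
    have h6 := mul_le_mul_of_nonneg_right h2 (show (0 : ℝ) ≤ 4 ^ m by positivity)
    rw [h5] at h6
    linarith
  have h4 : 4 * μ ^ t ≤ 1 := by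
    by_contra hcon
    push Not at hcon
    obtain ⟨m, hm⟩ := pow_unbounded_of_one_lt (Z * M ^ 2 / b 0) hcon
    exact absurd (hbound m) (not_le.2 hm)
  have hbern := one_add_mul_le_pow (a := μ - 1) (by linarith) t
  rw [show 1 + (μ - 1) = μ by ring] at hbern
  have hbern2 : 1 ≤ 2 * (t * (1 - μ)) := by linarith
  have h7 := mul_le_mul_of_nonneg_right hbern2 hpos'.le
  have h8 : μ * b 0 = b 1 := div_mul_cancel₀ _ hpos'.ne'
  have h9 : (b 0 - b 1) / 2 ≤ En a f := En_lower h f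
  have h10 : (t : ℝ) * ((b 0 - b 1) / 2) ≤ t * En a f :=
    mul_le_mul_of_nonneg_left h9 (Nat.cast_nonneg t)
  have h11 : N a f = b 0 := rfl
  have h12 : (N a ((T a)^[0] f)) = b 0 := rfl
  rw [h11]
  have : 2 * (t * (1 - μ)) * b 0 = 2 * (t * (b 0 - b 1)) := by rw [← h8]; ring
  linarith

/-- the mean minimizes the squared distance -/
lemma N_le_shift (h : Good a) (f : V → ℝ) (hf : ∑ v, dg a v * f v = 0) (μ : ℝ) :
    N a f ≤ N a (fun v => f v - μ) := by
  have e : N a (fun v => f v - μ) = N a f - 2 * μ * ∑ v, dg a v * f v + μ ^ 2 * ∑ v, dg a v := by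
    unfold N
    rw [Finset.mul_sum, Finset.mul_sum, ← Finset.sum_sub_distrib, ← Finset.sum_add_distrib]
    exact Finset.sum_congr rfl fun v _ => by ring
  rw [e, hf]
  have : 0 ≤ ∑ v, dg a v := Finset.sum_nonneg fun v _ => (h.pos v).le
  nlinarith [mul_nonneg (sq_nonneg μ) this]

lemma sum_dg_pos [Nonempty V] (h : Good a) : 0 < ∑ v, dg a v :=
  Finset.sum_pos (fun v _ => h.pos v) Finset.univ_nonempty

lemma center [Nonempty V] (h : Good a) (f : V → ℝ) :
    ∑ v, dg a v * (f v - (∑ v, dg a v * f v) / ∑ v, dg a v) = 0 := by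
  have := (sum_dg_pos h).ne'
  simp_rw [mul_sub]
  rw [Finset.sum_sub_distrib, ← Finset.sum_mul]
  field_simp
  ring

lemma compare [Nonempty V] {a' : V → V → ℝ} (h : Good a) (h' : Good a') (K R : ℝ) (hK : 0 ≤ K)
    (hR : 0 ≤ R)
    (h1 : ∀ u v, a u v ≤ K * a' u v) (h2 : ∀ u v, a' u v ≤ K * a u v)
    (hg : ∀ f : V → ℝ, ∑ v, dg a' v * f v = 0 → N a' f ≤ R * En a' f)
    (f : V → ℝ) (hf : ∑ v, dg a v * f v = 0) : N a f ≤ K ^ 2 * R * En a f := by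
  set μ := (∑ v, dg a' v * f v) / ∑ v, dg a' v with hμ
  have s1 := N_le_shift h f hf μ
  have s2 : N a (fun v => f v - μ) ≤ K * N a' (fun v => f v - μ) := by
    unfold N
    rw [Finset.mul_sum]
    refine Finset.sum_le_sum fun v _ => ?_
    rw [← mul_assoc]
    refine mul_le_mul_of_nonneg_right ?_ (sq_nonneg _)
    unfold dg
    rw [Finset.mul_sum]
    exact Finset.sum_le_sum fun w _ => h1 v w
  have s3 := hg (fun v => f v - μ) (center h' f)
  have s4 : En a' (fun v => f v - μ) ≤ K * En a f := by
    unfold En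
    have : ∑ v, ∑ w, a' v w * (f v - μ - (f w - μ)) ^ 2 ≤
        K * ∑ v, ∑ w, a v w * (f v - f w) ^ 2 := by
      simp_rw [Finset.mul_sum]
      refine Finset.sum_le_sum fun v _ => Finset.sum_le_sum fun w _ => ?_
      rw [← mul_assoc, sub_sub_sub_cancel_right]
      exact mul_le_mul_of_nonneg_right (h2 v w) (sq_nonneg _)
    linarith
  calc N a f ≤ K * N a' (fun v => f v - μ) := s1.trans s2
    _ ≤ K * (R * (K * En a f)) := by
        refine mul_le_mul_of_nonneg_left (s3.trans ?_) hK
        exact mul_le_mul_of_nonneg_left s4 hR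
    _ = _ := by ring

lemma decay (h : Good a) (R : ℝ) (hR : 1 ≤ R)
    (hg : ∀ f : V → ℝ, ∑ v, dg a v * f v = 0 → N a f ≤ R * En a f)
    (f : V → ℝ) (hf : ∑ v, dg a v * f v = 0) (s : ℕ) :
    N a ((T a)^[s] f) ≤ (1 - 1 / R) ^ s * N a f := by
  have hR0 : 0 < R := by linarith
  have hq : 0 ≤ 1 - 1 / R := by
    rw [sub_nonneg, div_le_one hR0]; exact hR
  induction s with
  | zero => simp
  | succ s ih =>
    rw [Function.iterate_succ_apply']
    have h1 := N_T_le h ((T a)^[s] f)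
    have h2 := hg ((T a)^[s] f) (by rw [mean_iter h, hf])
    have h3 : N a ((T a)^[s] f) / R ≤ En a ((T a)^[s] f) := by
      rw [div_le_iff₀ hR0]; linarith
    have h4 := mul_le_mul_of_nonneg_left ih hq
    have e : (1 - 1 / R) * N a ((T a)^[s] f) = N a ((T a)^[s] f) - N a ((T a)^[s] f) / R := by ring
    rw [pow_succ]
    linarith

/-- edge weights of a network -/
noncomputable def wt (G : SimpleGraph V) (c : V → V → ℝ) (v w : V) : ℝ :=
  if G.Adj v w then c v w else 0

lemma dg_wt (G : SimpleGraph V) (c : V → V → ℝ) (v : V) :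
    dg (wt G c) v = ∑ w ∈ Finset.univ.filter (G.Adj v ·), c v w := by
  unfold dg wt
  rw [Finset.sum_filter]

lemma kernel_mulVec (G : SimpleGraph V) (c : V → V → ℝ) (f : V → ℝ) :
    (lazyKernel G c).mulVec f = T (wt G c) f := by
  funext v
  simp only [Matrix.mulVec, dotProduct, lazyKernel, T, Q]
  rw [← dg_wt]
  simp_rw [add_mul]
  rw [Finset.sum_add_distrib, add_div]
  congr 1
  · simp [ite_mul]; ring
  · rw [Finset.sum_div, Finset.sum_div]
    refine Finset.sum_congr rfl fun w _ => ?_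
    unfold wt
    split_ifs
    · rw [div_div, div_mul_eq_mul_div, mul_comm (2 : ℝ)]
    · simp

lemma pow_mulVec [DecidableEq V] (G : SimpleGraph V) (c : V → V → ℝ) (t : ℕ) (f : V → ℝ) :
    (lazyKernel G c ^ t).mulVec f = (T (wt G c))^[t] f := by
  induction t with
  | zero => simp
  | succ t ih => rw [pow_succ', ← Matrix.mulVec_mulVec, ih, kernel_mulVec, Function.iterate_succ_apply']

lemma tv_pair [DecidableEq V] (G : SimpleGraph V) (c : V → V → ℝ) (t : ℕ) (f : V → ℝ) (v : V) :
    ∑ x, ((lazyKernel G c ^ t) v x - statDist G c x) * f x =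
      ((T (wt G c))^[t] f) v - (∑ x, dg (wt G c) x * f x) / ∑ x, dg (wt G c) x := by
  rw [← pow_mulVec]
  simp_rw [sub_mul]
  rw [Finset.sum_sub_distrib]
  congr 1
  rw [Finset.sum_div]
  refine Finset.sum_congr rfl fun x _ => ?_
  simp only [statDist, ← dg_wt]
  ring

lemma contract_of_tv [DecidableEq V] (G : SimpleGraph V) (c : V → V → ℝ) (t : ℕ) (v : V)
    (ht : tvDist ((lazyKernel G c ^ t) v) (statDist G c) ≤ 1 / 4)
    (f : V → ℝ) (M : ℝ) (hf : ∑ v, dg (wt G c) v * f v = 0) (hM : ∀ v, |f v| ≤ M) :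
    |((T (wt G c))^[t] f) v| ≤ M / 2 := by
  have e := tv_pair G c t f v
  rw [hf, zero_div, sub_zero] at e
  rw [← e]
  have hM0 : 0 ≤ M := (abs_nonneg _).trans (hM v)
  calc |∑ x, ((lazyKernel G c ^ t) v x - statDist G c x) * f x|
      ≤ ∑ x, |((lazyKernel G c ^ t) v x - statDist G c x) * f x| := Finset.abs_sum_le_sum_abs _ _
    _ ≤ ∑ x, |(lazyKernel G c ^ t) v x - statDist G c x| * M := by
        refine Finset.sum_le_sum fun x _ => ?_
        rw [abs_mul]
        exact mul_le_mul_of_nonneg_left (hM x) (abs_nonneg _)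
    _ = 2 * tvDist ((lazyKernel G c ^ t) v) (statDist G c) * M := by
        rw [← Finset.sum_mul]; unfold tvDist; ring
    _ ≤ 2 * (1 / 4) * M := by gcongr
    _ = M / 2 := by ring

lemma tv_of_gap [DecidableEq V] [Nonempty V] (G : SimpleGraph V) (c : V → V → ℝ)
    (h : Good (wt G c)) (R : ℝ) (hR : 1 ≤ R)
    (hg : ∀ f : V → ℝ, ∑ v, dg (wt G c) v * f v = 0 → N (wt G c) f ≤ R * En (wt G c) f)
    (h1 : ∀ v, 1 ≤ dg (wt G c) v) (s : ℕ)
    (hs : (1 - 1 / R) ^ s * (∑ v, dg (wt G c) v) ≤ 1 / 4) (v : V) :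
    tvDist ((lazyKernel G c ^ s) v) (statDist G c) ≤ 1 / 4 := by
  have hR0 : 0 < R := by linarith
  have hq : 0 ≤ 1 - 1 / R := by
    rw [sub_nonneg, div_le_one hR0]; exact hR
  set S : V → ℝ := fun x =>
    if 0 ≤ (lazyKernel G c ^ s) v x - statDist G c x then 1 else -1 with hS
  set μ := (∑ x, dg (wt G c) x * S x) / ∑ x, dg (wt G c) x with hμ
  have e := tv_pair G c s S v
  have e0 : ∑ x, ((lazyKernel G c ^ s) v x - statDist G c x) * S x =
      ∑ x, |(lazyKernel G c ^ s) v x - statDist G c x| := by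
    refine Finset.sum_congr rfl fun x _ => ?_
    simp only [hS]
    split_ifs with hx
    · rw [abs_of_nonneg hx, mul_one]
    · rw [abs_of_neg (not_le.1 hx)]; ring
  have hcen := center h S
  have e1 := congrFun (iter_sub_const h s S μ) v
  have d := decay h R hR hg (fun x => S x - μ) hcen s
  have hn : N (wt G c) (fun x => S x - μ) ≤ ∑ x, dg (wt G c) x := by
    have := N_le_shift h (fun x => S x - μ) hcen (-μ)
    refine this.trans (le_of_eq ?_)
    unfold N
    refine Finset.sum_congr rfl fun x _ => ?_
    simp only [hS]
    split_ifs <;> ring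
  have d2 : N (wt G c) ((T (wt G c))^[s] fun x => S x - μ) ≤ 1 / 4 :=
    d.trans ((mul_le_mul_of_nonneg_left hn (pow_nonneg hq s)).trans hs)
  have d3 : dg (wt G c) v * ((T (wt G c))^[s] (fun x => S x - μ)) v ^ 2 ≤ 1 / 4 :=
    (Finset.single_le_sum
      (f := fun v => dg (wt G c) v * ((T (wt G c))^[s] (fun x => S x - μ)) v ^ 2)
      (fun i _ => mul_nonneg (h.pos i).le (sq_nonneg _)) (Finset.mem_univ v)).trans d2
  have d4 : ((T (wt G c))^[s] (fun x => S x - μ)) v ^ 2 ≤ 1 / 4 := by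
    have := mul_le_mul_of_nonneg_right (h1 v)
      (sq_nonneg (((T (wt G c))^[s] (fun x => S x - μ)) v))
    linarith
  have d5 : ((T (wt G c))^[s] (fun x => S x - μ)) v ≤ 1 / 2 := by
    nlinarith
  unfold tvDist
  rw [← e0, e]
  rw [e1] at d5
  linarith

lemma qual_gap [Nonempty V] (G : SimpleGraph V) (hG : G.Connected) (c : V → V → ℝ)
    (h : Good (wt G c)) (hc : ∀ u v, G.Adj u v → 1 ≤ c u v) :
    ∃ R : ℝ, 1 ≤ R ∧
      ∀ f : V → ℝ, ∑ v, dg (wt G c) v * f v = 0 → N (wt G c) f ≤ R * En (wt G c) f := by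
  obtain ⟨v0⟩ := ‹Nonempty V›
  have step : ∀ u v, G.Adj u v → ∀ f : V → ℝ, (f u - f v) ^ 2 ≤ 4 * En (wt G c) f := by
    intro u v huv f
    have hnn : ∀ x y, 0 ≤ wt G c x y * (f x - f y) ^ 2 := fun x y =>
      mul_nonneg (h.nonneg _ _) (sq_nonneg _)
    have i1 : wt G c u v * (f u - f v) ^ 2 ≤ ∑ w, wt G c u w * (f u - f w) ^ 2 :=
      Finset.single_le_sum (f := fun w => wt G c u w * (f u - f w) ^ 2)
        (fun i _ => hnn u i) (Finset.mem_univ v)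
    have i2 : ∑ w, wt G c u w * (f u - f w) ^ 2 ≤ ∑ x, ∑ w, wt G c x w * (f x - f w) ^ 2 :=
      Finset.single_le_sum (f := fun x => ∑ w, wt G c x w * (f x - f w) ^ 2)
        (fun i _ => Finset.sum_nonneg fun j _ => hnn i j) (Finset.mem_univ u)
    have i3 : 1 ≤ wt G c u v := by unfold wt; rw [if_pos huv]; exact hc u v huv
    have i4 := mul_le_mul_of_nonneg_right i3 (sq_nonneg (f u - f v))
    unfold En
    linarith
  have reach : ∀ u, ∃ r : ℝ, 0 ≤ r ∧ ∀ f : V → ℝ, (f u - f v0) ^ 2 ≤ r * En (wt G c) f := by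
    intro u
    obtain ⟨p⟩ := hG.preconnected u v0
    induction p with
    | nil => exact ⟨0, le_rfl, fun f => by simp⟩
    | cons hadj p ih =>
      obtain ⟨r, hr, hrf⟩ := ih
      refine ⟨2 * r + 8, by linarith, fun f => ?_⟩
      rename_i x y z
      have j1 := step _ _ hadj f
      have j2 := hrf f
      nlinarith [sq_nonneg ((f x - f y) - (f y - f z))]
  choose r hr hrf using reach
  refine ⟨1 + ∑ u, dg (wt G c) u * r u, ?_, fun f hf => ?_⟩
  · have : 0 ≤ ∑ u, dg (wt G c) u * r u :=
      Finset.sum_nonneg fun u _ => mul_nonneg (h.pos u).le (hr u)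
    linarith
  · have k1 := N_le_shift h f hf (f v0)
    have k2 : N (wt G c) (fun v => f v - f v0) ≤ (∑ u, dg (wt G c) u * r u) * En (wt G c) f := by
      unfold N
      rw [Finset.sum_mul]
      refine Finset.sum_le_sum fun u _ => ?_
      rw [mul_assoc]
      exact mul_le_mul_of_nonneg_left (hrf u f) (h.pos u).le
    have := En_nonneg h f
    linarith

lemma mem_mixing [DecidableEq V] [Nonempty V] (G : SimpleGraph V) (hG : G.Connected)
    (c : V → V → ℝ) (h : Good (wt G c)) (hc : ∀ u v, G.Adj u v → 1 ≤ c u v)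
    (h1 : ∀ v, 1 ≤ dg (wt G c) v) (v : V) :
    tvDist ((lazyKernel G c ^ (mixingTimeFrom G c v)) v) (statDist G c) ≤ 1 / 4 := by
  obtain ⟨R, hR, hg⟩ := qual_gap G hG c h hc
  have hR0 : 0 < R := by linarith
  have hZ := sum_dg_pos h
  obtain ⟨s, hs⟩ := exists_pow_lt_of_lt_one
    (show 0 < 1 / 4 / (∑ v, dg (wt G c) v) by positivity)
    (show 1 - 1 / R < 1 by have : 0 < 1 / R := by positivity
                           linarith)
  have hs' : (1 - 1 / R) ^ s * (∑ v, dg (wt G c) v) ≤ 1 / 4 :=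
    ((lt_div_iff₀ hZ).1 hs).le
  exact Nat.sInf_mem (s := {t : ℕ | tvDist ((lazyKernel G c ^ t) v) (statDist G c) ≤ 1 / 4})
    ⟨s, tv_of_gap G c h R hR hg h1 s hs' v⟩

lemma gap_of_mixing [DecidableEq V] [Nonempty V] (G : SimpleGraph V) (hG : G.Connected)
    (c : V → V → ℝ) (h : Good (wt G c)) (hc : ∀ u v, G.Adj u v → 1 ≤ c u v)
    (h1 : ∀ v, 1 ≤ dg (wt G c) v) (f : V → ℝ) (hf : ∑ v, dg (wt G c) v * f v = 0) :
    N (wt G c) f ≤ 4 * (1 + mixingTime G c) * En (wt G c) f := by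
  have key : N (wt G c) f ≤ 4 * (mixingTime G c) * En (wt G c) f := by
    refine gap_of_contract h _ (fun g M hg hM v => ?_) f hf
    have hle : mixingTimeFrom G c v ≤ mixingTime G c :=
      Finset.le_sup (f := fun v => mixingTimeFrom G c v) (Finset.mem_univ v)
    obtain ⟨k, hk⟩ := Nat.exists_eq_add_of_le hle
    rw [hk, Function.iterate_add_apply]
    exact contract_of_tv G c _ v (mem_mixing G hG c h hc h1 v) _ M
      (by rw [mean_iter h, hg]) (sup_iter h k g M hM)
  have := En_nonneg h f
  linarith

lemma one_side [DecidableEq V] [Nonempty V] (G : SimpleGraph V) (hG : G.Connected)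
    (c c' : V → V → ℝ) (h : Good (wt G c)) (h' : Good (wt G c'))
    (hc' : ∀ u v, G.Adj u v → 1 ≤ c' u v)
    (h1 : ∀ v, 1 ≤ dg (wt G c) v) (h1' : ∀ v, 1 ≤ dg (wt G c') v)
    (K : ℝ) (hK : 1 ≤ K) (D : ℝ) (hD : 1 ≤ D)
    (k1 : ∀ u v, wt G c u v ≤ K * wt G c' u v) (k2 : ∀ u v, wt G c' u v ≤ K * wt G c u v)
    (hdeg : ∀ v, dg (wt G c) v ≤ D) (hn : 3 ≤ Fintype.card V) :
    (mixingTime G c : ℝ) ≤ (4 * K ^ 2 * (2 + Real.log (4 * D))) * (1 + (mixingTime G c' : ℝ)) *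
      Real.log (Fintype.card V) := by
  set t : ℝ := (mixingTime G c' : ℝ) with ht
  have ht0 : 0 ≤ t := Nat.cast_nonneg _
  set R : ℝ := K ^ 2 * (4 * (1 + t)) with hRdef
  have hK2 : 1 ≤ K ^ 2 := one_le_pow₀ hK
  have hR : 1 ≤ R := by nlinarith
  have hR0 : 0 < R := by linarith
  have hg := compare h h' K (4 * (1 + t)) (by linarith) (by linarith) k1 k2
    (gap_of_mixing G hG c' h' hc' h1')
  set n : ℝ := (Fintype.card V : ℝ) with hndef
  have hn3 : (3 : ℝ) ≤ n := by rw [hndef]; exact_mod_cast hn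
  have hlogn : 1 ≤ Real.log n := by
    rw [Real.le_log_iff_exp_le (by linarith)]
    linarith [Real.exp_one_lt_d9]
  have hL : 0 ≤ Real.log (4 * D) := Real.log_nonneg (by linarith)
  set x : ℝ := R * (Real.log n + Real.log (4 * D)) with hx
  have hx0 : 0 ≤ x := by positivity
  set s := ⌈x⌉₊ with hs
  have hsx : x ≤ s := Nat.le_ceil x
  have hsu : (s : ℝ) < x + 1 := Nat.ceil_lt_add_one hx0
  have hZ : ∑ v, dg (wt G c) v ≤ n * D := by
    calc ∑ v, dg (wt G c) v ≤ ∑ _v : V, D := Finset.sum_le_sum fun v _ => hdeg v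
      _ = n * D := by simp [hndef]
  have hq : 0 ≤ 1 - 1 / R := by
    rw [sub_nonneg, div_le_one hR0]; exact hR
  have hpow : (1 - 1 / R) ^ s ≤ 1 / (n * (4 * D)) := by
    calc (1 - 1 / R) ^ s ≤ (Real.exp (-(1 / R))) ^ s :=
          pow_le_pow_left₀ hq (by linarith [Real.add_one_le_exp (-(1 / R))]) s
      _ = Real.exp (s * (-(1 / R))) := by rw [Real.exp_nat_mul]
      _ ≤ Real.exp (-(Real.log n + Real.log (4 * D))) := by
          apply Real.exp_le_exp.2
          have : (Real.log n + Real.log (4 * D)) ≤ s * (1 / R) := by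
            rw [mul_one_div, le_div_iff₀ hR0]; linarith
          linarith
      _ = 1 / (n * (4 * D)) := by
          rw [← Real.log_mul (by linarith) (by linarith), Real.exp_neg,
            Real.exp_log (by positivity), one_div]
  have hfin : (1 - 1 / R) ^ s * (∑ v, dg (wt G c) v) ≤ 1 / 4 := by
    calc (1 - 1 / R) ^ s * (∑ v, dg (wt G c) v) ≤ 1 / (n * (4 * D)) * (n * D) :=
          mul_le_mul hpow hZ (sum_dg_pos h).le (by positivity)
      _ = 1 / 4 := by field_simp
  have hmix : mixingTime G c ≤ s := by
    refine Finset.sup_le fun v _ => Nat.sInf_le ?_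
    exact tv_of_gap G c h R hR hg h1 s hfin v
  have hmix' : (mixingTime G c : ℝ) ≤ s := by exact_mod_cast hmix
  have hRl : 1 ≤ R * Real.log n := one_le_mul_of_one_le_of_one_le hR hlogn
  have hLn : Real.log (4 * D) ≤ Real.log (4 * D) * Real.log n := le_mul_of_one_le_right hL hlogn
  have hLn' := mul_le_mul_of_nonneg_left hLn hR0.le
  have : (4 * K ^ 2 * (2 + Real.log (4 * D))) * (1 + t) * Real.log n =
      2 * (R * Real.log n) + R * (Real.log (4 * D) * Real.log n) := by rw [hRdef]; ring
  rw [this]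
  have hxx : x = R * Real.log n + R * Real.log (4 * D) := by rw [hx]; ring
  linarith

lemma net_facts [Nonempty V] (G : SimpleGraph V) (hG : G.Connected)
    (hn : 3 ≤ Fintype.card V) (Δ : ℕ) (hΔ : ∀ v, {u | G.Adj v u}.ncard ≤ Δ)
    (C : ℝ) (hC : 1 ≤ C) (c : V → V → ℝ) (hs : ∀ u v, c u v = c v u)
    (hc : ∀ u v, G.Adj u v → 1 ≤ c u v ∧ c u v ≤ C) :
    Good (wt G c) ∧ (∀ v, 1 ≤ dg (wt G c) v) ∧ ∀ v, dg (wt G c) v ≤ C * (Δ + 1) := by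
  have hnn : ∀ u v, 0 ≤ wt G c u v := fun u v => by
    unfold wt; split_ifs with hu
    · linarith [(hc u v hu).1]
    · exact le_rfl
  have h1 : ∀ v, 1 ≤ dg (wt G c) v := by
    intro v
    haveI : Nontrivial V := Fintype.one_lt_card_iff_nontrivial.1 (by omega)
    obtain ⟨w, hw⟩ := hG.preconnected.exists_adj_of_nontrivial v
    have i1 : wt G c v w ≤ dg (wt G c) v :=
      Finset.single_le_sum (f := fun w => wt G c v w) (fun i _ => hnn v i) (Finset.mem_univ w)
    refine le_trans ?_ i1
    unfold wt; rw [if_pos hw]; exact (hc v w hw).1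
  refine ⟨⟨fun u v => ?_, hnn, fun v => by linarith [h1 v]⟩, h1, fun v => ?_⟩
  · unfold wt; simp only [G.adj_comm u v, hs u v]
  · rw [dg_wt]
    have hcard : (Finset.univ.filter (G.Adj v ·)).card ≤ Δ := by
      have := hΔ v
      rw [Set.ncard_eq_toFinset_card'] at this
      convert this using 2
      ext; simp
    calc ∑ w ∈ Finset.univ.filter (G.Adj v ·), c v w
        ≤ ∑ w ∈ Finset.univ.filter (G.Adj v ·), C :=
          Finset.sum_le_sum fun w hw => (hc v w (by simpa using hw)).2
      _ = (Finset.univ.filter (G.Adj v ·)).card * C := by simp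
      _ ≤ Δ * C := by gcongr
      _ ≤ C * (Δ + 1) := by nlinarith

end MixRobust

/-- **Bounded perturbations change mixing times of bounded-degree graphs by at most a
`log n` factor**: for every `C ≥ 1` and `Δ` there is `A < ∞` such that for every
finite connected graph on `n ≥ 3` vertices with maximum degree at most `Δ` and every
conductance function with values in `[1, C]`,
`t_mix(G,c) ≤ A (1 + t_mix(G,1)) log n` and `t_mix(G,1) ≤ A (1 + t_mix(G,c)) log n`. -/
theorem mixing_time_log_robust (C : ℝ) (hC : 1 ≤ C) (Δ : ℕ) :
    ∃ A : ℝ, ∀ (W : Type) [Fintype W] [DecidableEq W] (G : SimpleGraph W),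
      G.Connected → 3 ≤ Fintype.card W → (∀ v, {u | G.Adj v u}.ncard ≤ Δ) →
      ∀ c : W → W → ℝ, (∀ u v, c u v = c v u) →
        (∀ u v, G.Adj u v → 1 ≤ c u v ∧ c u v ≤ C) →
        (mixingTime G c : ℝ) ≤
            A * (1 + (mixingTime G (fun _ _ => 1) : ℝ)) * Real.log (Fintype.card W) ∧
          (mixingTime G (fun _ _ => 1) : ℝ) ≤
            A * (1 + (mixingTime G c : ℝ)) * Real.log (Fintype.card W) := by
  refine ⟨4 * C ^ 2 * (2 + Real.log (4 * (C * (Δ + 1)))), ?_⟩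
  intro W _ _ G hG hn hΔ c hs hc
  haveI : Nonempty W := hG.nonempty
  obtain ⟨g1, l1, u1⟩ := MixRobust.net_facts G hG hn Δ hΔ C hC c hs hc
  obtain ⟨g2, l2, u2⟩ := MixRobust.net_facts G hG hn Δ hΔ C hC (fun _ _ => 1)
    (fun _ _ => rfl) (fun _ _ _ => ⟨le_rfl, hC⟩)
  have hD : 1 ≤ C * ((Δ : ℝ) + 1) := by
    have : (0 : ℝ) ≤ Δ := Nat.cast_nonneg _
    nlinarith
  have k1 : ∀ u v, MixRobust.wt G c u v ≤ C * MixRobust.wt G (fun _ _ => 1) u v := by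
    intro u v
    unfold MixRobust.wt
    split_ifs with hu
    · linarith [(hc u v hu).2]
    · simp
  have k2 : ∀ u v, MixRobust.wt G (fun _ _ => 1) u v ≤ C * MixRobust.wt G c u v := by
    intro u v
    unfold MixRobust.wt
    split_ifs with hu
    · nlinarith [(hc u v hu).1]
    · simp
  exact ⟨MixRobust.one_side G hG c _ g1 g2 (fun _ _ _ => le_rfl) l1 l2 C hC _ hD k1 k2 u1 hn,
    MixRobust.one_side G hG _ c g2 g1 (fun u v huv => (hc u v huv).1) l2 l1 C hC _ hD k2 k1 u2 hn⟩
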